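/- arXiv:2412.11221 — 2 statements merged into one kernel-verified Lean document; each statement's English description precedes it below -/
import Mathlib

section
/- Let (X,d) be a compact metric space and F : X → 2^X a set-valued map with nonempty compact values which is open, onto and continuous. Then F has the shadowing property if and only if the inverse set-valued map F⁻¹, defined by F⁻¹(x) = {z ∈ X : x ∈ F(z)}, has the shadowing property. -/
open Metric Set

variable {X : Type*} [MetricSpace X]

/-- A set-valued map `F : X → 2^X` is *upper semicontinuous* if for every `x` and every open
`U ⊇ F x` there is an open neighborhood `V` of `x` with `F y ⊆ U` for all `y ∈ V`. -/
def SVUpperSC (F : X → Set X) : Prop :=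
  ∀ x : X, ∀ U : Set X, IsOpen U → F x ⊆ U →
    ∃ V : Set X, IsOpen V ∧ x ∈ V ∧ ∀ y ∈ V, F y ⊆ U

/-- A set-valued map is *lower semicontinuous* if for every `x` and every open `U` meeting
`F x` there is an open neighborhood `V` of `x` with `F y ∩ U ≠ ∅` for all `y ∈ V`. -/
def SVLowerSC (F : X → Set X) : Prop :=
  ∀ x : X, ∀ U : Set X, IsOpen U → (F x ∩ U).Nonempty →
    ∃ V : Set X, IsOpen V ∧ x ∈ V ∧ ∀ y ∈ V, (F y ∩ U).Nonempty

/-- A set-valued map is *continuous* if it is both upper and lower semicontinuous. -/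
def SVContinuous (F : X → Set X) : Prop := SVUpperSC F ∧ SVLowerSC F

/-- `F` has nonempty compact values. -/
def SVCompactValued (F : X → Set X) : Prop := ∀ x : X, (F x).Nonempty ∧ IsCompact (F x)

/-- Image of a set under a set-valued map: `F(U) = ⋃_{x ∈ U} F x`. -/
def SVImage (F : X → Set X) (U : Set X) : Set X := ⋃ x ∈ U, F x

/-- A set-valued map is *open* if it maps open sets to open sets. -/
def SVOpen (F : X → Set X) : Prop := ∀ U : Set X, IsOpen U → IsOpen (SVImage F U)

/-- A set-valued map is *onto* if every point lies in some value. -/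
def SVOnto (F : X → Set X) : Prop := ∀ y : X, ∃ x : X, y ∈ F x

/-- The inverse set-valued map `F⁻¹(x) = {z : x ∈ F z}`. -/
def SVInv (F : X → Set X) : X → Set X := fun x => {z | x ∈ F z}

/-- The orbit space `Orb_r(X) = {(x_n) : x_{n+1} ∈ F(x_n)}`. -/
def OrbR (F : X → Set X) : Set (ℕ → X) := {u | ∀ n : ℕ, u (n + 1) ∈ F (u n)}

/-- The left orbit space `Orb_l(X) = {(…,x_{-1},x_0) : x_i ∈ F(x_{i+1})}`, encoded by
`u n = x_{-n}`, so the defining condition reads `u (n+1) ∈ F (u n)`. -/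
def OrbL (F : X → Set X) : Set (ℕ → X) := {u | ∀ n : ℕ, u (n + 1) ∈ F (u n)}

/-- The inverse orbit space `Orb_inv(X) = {(x_n) : x_n ∈ F(x_{n+1})}`. -/
def OrbInv (F : X → Set X) : Set (ℕ → X) := {u | ∀ n : ℕ, u n ∈ F (u (n + 1))}

/-- The shift on sequences. -/
def shiftSeq (u : ℕ → X) : ℕ → X := fun n => u (n + 1)

/-- The shift map `σ_rF : Orb_r(X) → Orb_r(X)`, `(x_n) ↦ (x_{n+1})`. -/
def sigmaR (F : X → Set X) : OrbR F → OrbR F :=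
  fun u => ⟨shiftSeq u.1, fun n => u.2 (n + 1)⟩

/-- The shift map `σ_lF : Orb_l(X) → Orb_l(X)`, `(x_{-n}) ↦ (x_{-n-1})`, in the encoding
`u n = x_{-n}`. -/
def sigmaL (F : X → Set X) : OrbL F → OrbL F :=
  fun u => ⟨shiftSeq u.1, fun n => u.2 (n + 1)⟩

/-- The metric `ρ((x_n),(y_n)) = Σ_{n≥0} d(x_n,y_n)/2^{n+1}` on sequence space. -/
noncomputable def rho (u v : ℕ → X) : ℝ := ∑' n : ℕ, dist (u n) (v n) / 2 ^ (n + 1)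

/-- `ρ`-distance from a point to a set of sequences. -/
noncomputable def rhoInf (u : ℕ → X) (B : Set (ℕ → X)) : ℝ := sInf (rho u '' B)

/-- Hausdorff distance with respect to `ρ` between two sets of sequences. -/
noncomputable def rhoHaus (A B : Set (ℕ → X)) : ℝ :=
  max (sSup ((fun u => rhoInf u B) '' A)) (sSup ((fun v => rhoInf v A) '' B))

/-- The shadowing property for a set-valued map: every `δ`-pseudo-orbit
(`d(x_{n+1}, F(x_n)) < δ`) is `ε`-shadowed by an `F`-orbit. -/
def SVShadowing (F : X → Set X) : Prop :=
  ∀ ε > (0 : ℝ), ∃ δ > (0 : ℝ), ∀ x : ℕ → X,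
    (∀ n : ℕ, infDist (x (n + 1)) (F (x n)) < δ) →
    ∃ y : ℕ → X, (∀ n : ℕ, y (n + 1) ∈ F (y n)) ∧ ∀ n : ℕ, dist (x n) (y n) < ε

/-- The (single-valued) shadowing property for the shift `σ_rF` on `(Orb_r(X), ρ)`. -/
def ShiftShadowingR (F : X → Set X) : Prop :=
  ∀ ε > (0 : ℝ), ∃ δ > (0 : ℝ), ∀ z : ℕ → (ℕ → X),
    (∀ n : ℕ, z n ∈ OrbR F) →
    (∀ n : ℕ, rho (shiftSeq (z n)) (z (n + 1)) < δ) →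
    ∃ w ∈ OrbR F, ∀ n : ℕ, rho (shiftSeq^[n] w) (z n) < ε

/-- The (single-valued) shadowing property for the shift `σ_lF` on `(Orb_l(X), ρ)`. -/
def ShiftShadowingL (F : X → Set X) : Prop :=
  ∀ ε > (0 : ℝ), ∃ δ > (0 : ℝ), ∀ z : ℕ → (ℕ → X),
    (∀ n : ℕ, z n ∈ OrbL F) →
    (∀ n : ℕ, rho (shiftSeq (z n)) (z (n + 1)) < δ) →
    ∃ w ∈ OrbL F, ∀ n : ℕ, rho (shiftSeq^[n] w) (z n) < ε

/-- `F` is expansive with expansive constant `δ`. -/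
def SVExpansiveWith (F : X → Set X) (δ : ℝ) : Prop :=
  ∀ u ∈ OrbR F, ∀ v ∈ OrbR F, (∀ n : ℕ, dist (u n) (v n) < δ) → u 0 = v 0

/-- The shift `σ_rF` is expansive (as a single-valued map on `(Orb_r(X), ρ)`)
with expansive constant `c`. -/
def ShiftExpansiveWith (F : X → Set X) (c : ℝ) : Prop :=
  ∀ u ∈ OrbR F, ∀ v ∈ OrbR F,
    (∀ k : ℕ, rho (shiftSeq^[k] u) (shiftSeq^[k] v) ≤ c) → u = v

/-- The induced set-valued map `F_inv` on `Orb_inv(X)`: `F_inv([x_n]) = F(x_0) × [x_n]`,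
i.e. all sequences `(z, x_0, x_1, …)` with `z ∈ F(x_0)`. -/
def Finv (F : X → Set X) (u : ℕ → X) : Set (ℕ → X) :=
  {v | v 0 ∈ F (u 0) ∧ ∀ n : ℕ, v (n + 1) = u n}

/-- The shadowing property of `F_inv` as a set-valued map on `(Orb_inv(X), ρ)`. -/
def FinvShadowing (F : X → Set X) : Prop :=
  ∀ ε > (0 : ℝ), ∃ δ > (0 : ℝ), ∀ x : ℕ → (ℕ → X),
    (∀ n : ℕ, x n ∈ OrbInv F) →
    (∀ n : ℕ, rhoInf (x (n + 1)) (Finv F (x n)) < δ) →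
    ∃ y : ℕ → (ℕ → X), (∀ n : ℕ, y n ∈ OrbInv F) ∧
      (∀ n : ℕ, y (n + 1) ∈ Finv F (y n)) ∧ ∀ n : ℕ, rho (x n) (y n) < ε

/-- Iterates of a set-valued map: `F^0(x) = {x}`, `F^{k+1}(x) = ⋃_{z ∈ F^k(x)} F z`. -/
def SVIter (F : X → Set X) : ℕ → X → Set X
  | 0 => fun x => {x}
  | n + 1 => fun x => SVImage F (SVIter F n x)

/-- An upper semicontinuous compact-valued map has closed graph. -/
theorem SVUpperSC.isClosed_graph {F : X → Set X} (hF : SVUpperSC F) (hFc : SVCompactValued F) :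
    IsClosed {p : X × X | p.2 ∈ F p.1} := by
  rw [← isOpen_compl_iff, isOpen_iff_mem_nhds]
  rintro ⟨x, y⟩ hxy
  have hdisj : Disjoint (F x) {y} := disjoint_singleton_right.2 hxy
  obtain ⟨U, W, hU, hW, hFU, hyW, hUW⟩ :=
    SeparatedNhds.of_isCompact_isCompact (hFc x).2 isCompact_singleton hdisj
  obtain ⟨V, hV, hxV, hVU⟩ := hF x U hU hFU
  filter_upwards [(hV.prod hW).mem_nhds ⟨hxV, hyW rfl⟩] with p hp hpF
  exact disjoint_left.1 hUW (hVU p.1 hp.1 hpF) hp.2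

/-- The inverse of an open set-valued map is lower semicontinuous. -/
theorem SVOpen.lowerSC_inv {F : X → Set X} (hF : SVOpen F) : SVLowerSC (SVInv F) := by
  rintro x U hU ⟨z, hz, hzU⟩
  refine ⟨SVImage F U, hF U hU, mem_iUnion₂.2 ⟨z, hzU, hz⟩, fun y hy => ?_⟩
  obtain ⟨w, hw, hyw⟩ := mem_iUnion₂.1 hy
  exact ⟨w, hyw, hw⟩

/-- On a compact space, a lower semicontinuous map with closed graph is uniformly lower
semicontinuous. -/
theorem SVLowerSC.exists_uniform [CompactSpace X] {F : X → Set X} (hF : SVLowerSC F)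
    (hG : IsClosed {p : X × X | p.2 ∈ F p.1}) {ε : ℝ} (hε : 0 < ε) :
    ∃ δ > 0, ∀ z w y : X, dist w z < δ → y ∈ F z → infDist y (F w) < ε := by
  have hloc : ∀ p : {p : X × X | p.2 ∈ F p.1}, ∃ V : Set X, IsOpen V ∧ p.1.1 ∈ V ∧
      ∀ w ∈ V, (F w ∩ ball p.1.2 (ε / 2)).Nonempty := fun p =>
    hF p.1.1 _ isOpen_ball ⟨p.1.2, p.2, mem_ball_self (half_pos hε)⟩
  choose V hVo hV hVF using hloc
  obtain ⟨δ, hδ, hball⟩ := lebesgue_number_lemma_of_metric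
    (c := fun p => V p ×ˢ ball p.1.2 (ε / 2)) hG.isCompact
    (fun p => (hVo p).prod isOpen_ball)
    (fun p hp => mem_iUnion.2 ⟨⟨p, hp⟩, hV _, mem_ball_self (half_pos hε)⟩)
  refine ⟨δ, hδ, fun z w y hwz hy => ?_⟩
  obtain ⟨p, hp⟩ := hball (z, y) hy
  have hwy : (w, y) ∈ ball (z, y) δ := by
    simp [Prod.dist_eq, hwz]
  obtain ⟨hw, hyp⟩ := hp hwy
  obtain ⟨t, ht, htp⟩ := hVF p w hw
  calc infDist y (F w) ≤ dist y t := infDist_le_dist_of_mem ht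
    _ ≤ dist y p.1.2 + dist t p.1.2 := dist_triangle_right _ _ _
    _ < ε / 2 + ε / 2 := add_lt_add hyp htp
    _ = ε := add_halves ε

/-- If every finite initial segment of `x` is shadowed within `ε` by an orbit segment of a map
with closed graph on a compact space, then `x` is shadowed within `ε` by an orbit. -/
theorem exists_orbit_of_finite_shadowing [CompactSpace X] {G : X → Set X}
    (hG : IsClosed {p : X × X | p.2 ∈ G p.1}) {x : ℕ → X} {ε : ℝ}
    (h : ∀ N : ℕ, ∃ v : ℕ → X, (∀ k < N, v (k + 1) ∈ G (v k)) ∧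
      ∀ k ≤ N, dist (x k) (v k) ≤ ε) :
    ∃ v : ℕ → X, (∀ k, v (k + 1) ∈ G (v k)) ∧ ∀ k, dist (x k) (v k) ≤ ε := by
  let K : ℕ → Set (ℕ → X) := fun N =>
    {v | (∀ k < N, v (k + 1) ∈ G (v k)) ∧ ∀ k ≤ N, dist (x k) (v k) ≤ ε}
  have hK : ∀ N, IsClosed (K N) := by
    intro N
    have hK_eq : K N = (⋂ k, ⋂ (_ : k < N), {v : ℕ → X | v (k + 1) ∈ G (v k)}) ∩
        ⋂ k, ⋂ (_ : k ≤ N), {v : ℕ → X | dist (x k) (v k) ≤ ε} := by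
      ext v
      simp [K]
    rw [hK_eq]
    refine (isClosed_biInter fun k _ => ?_).inter (isClosed_biInter fun k _ => ?_)
    · have hcont : Continuous fun v : ℕ → X => (v k, v (k + 1)) := by fun_prop
      exact hG.preimage hcont
    · exact isClosed_le (continuous_const.dist (continuous_apply k)) continuous_const
  obtain ⟨v, hv⟩ := IsCompact.nonempty_iInter_of_sequence_nonempty_isCompact_isClosed K
    (fun N v hv => ⟨fun k hk => hv.1 k (by lia), fun k hk => hv.2 k (by lia)⟩)
    h (hK 0).isCompact hK
  rw [mem_iInter] at hv
  exact ⟨v, fun k => (hv (k + 1)).1 k k.lt_succ_self, fun k => (hv k).2 k le_rfl⟩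

theorem SVShadowing.inv [CompactSpace X] {F : X → Set X} (hshadow : SVShadowing F)
    (hF : SVLowerSC F) (hG : IsClosed {p : X × X | p.2 ∈ F p.1})
    (hne : ∀ x, (F x).Nonempty) (honto : SVOnto F) : SVShadowing (SVInv F) := by
  intro ε hε
  obtain ⟨η, hη, hηs⟩ := hshadow (ε / 2) (half_pos hε)
  obtain ⟨δ, hδ, hunif⟩ := hF.exists_uniform hG hη
  refine ⟨δ, hδ, fun x hx => ?_⟩
  have hback : ∀ n, infDist (x n) (F (x (n + 1))) < η := fun n => by
    obtain ⟨z, hz, hxz⟩ := (infDist_lt_iff (honto (x n))).1 (hx n)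
    exact hunif z _ _ hxz hz
  choose f hf using hne
  have hGinv : IsClosed {p : X × X | p.2 ∈ SVInv F p.1} := hG.preimage continuous_swap
  suffices h : ∃ v : ℕ → X, (∀ k, v (k + 1) ∈ SVInv F (v k)) ∧
      ∀ k, dist (x k) (v k) ≤ ε / 2 by
    obtain ⟨v, hv, hxv⟩ := h
    exact ⟨v, hv, fun n => (hxv n).trans_lt (half_lt_self hε)⟩
  refine exists_orbit_of_finite_shadowing hGinv fun N => ?_
  obtain ⟨y, hy, hyd⟩ := hηs (fun k => f^[k - N] (x (N - k))) fun k => by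
    rcases lt_or_ge k N with hk | hk
    · have h₁ : N - k = N - (k + 1) + 1 := by lia
      have h₂ : k + 1 - N = 0 := by lia
      have h₃ : k - N = 0 := by lia
      simpa only [h₁, h₂, h₃, Function.iterate_zero, id] using hback (N - (k + 1))
    · have h₁ : k + 1 - N = k - N + 1 := by lia
      have h₂ : N - (k + 1) = N - k := by lia
      simp only [h₁, h₂, Function.iterate_succ_apply']
      rwa [infDist_zero_of_mem (hf _)]
  refine ⟨fun k => y (N - k), fun k hk => ?_, fun k hk => ?_⟩
  · have h₁ : N - k = N - (k + 1) + 1 := by lia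
    simpa only [SVInv, mem_ofPred_eq, h₁] using hy (N - (k + 1))
  · have h₁ : N - k - N = 0 := by lia
    have h₂ : N - (N - k) = k := by lia
    simpa only [h₁, h₂, Function.iterate_zero, id] using (hyd (N - k)).le

/-- If `F` is an open, onto and continuous set-valued map with nonempty
compact values on a compact metric space, then `F` has the shadowing property iff `F⁻¹` has
the shadowing property. -/
theorem shadowing_iff_inv_shadowing [CompactSpace X]
    (F : X → Set X) (hopen : SVOpen F) (honto : SVOnto F) (hF : SVContinuous F)
    (hFc : SVCompactValued F) :
    SVShadowing F ↔ SVShadowing (SVInv F) := by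
  have hG := hF.1.isClosed_graph hFc
  have hGinv : IsClosed {p : X × X | p.2 ∈ SVInv F p.1} := hG.preimage continuous_swap
  exact ⟨fun h => h.inv hF.2 hG (fun x => (hFc x).1) honto,
    fun h => h.inv hopen.lowerSC_inv hGinv honto fun x => (hFc x).1⟩
end

section
/- Let (X,d) be a compact metric space of diameter at most 1 and F : X → 2^X a continuous set-valued map with nonempty compact values. Then F has the shadowing property (in the set-valued sense) if and only if the shift map σ_lF on the left orbit space Orb_l(X) has the shadowing property (in the single-valued sense). -/
open Metric Set

variable {X : Type*} [MetricSpace X]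

section RhoEstimates

lemma summable_rho (hd : ∀ a b : X, dist a b ≤ 1) (u v : ℕ → X) :
    Summable fun n : ℕ => dist (u n) (v n) / 2 ^ (n + 1) := by
  refine Summable.of_nonneg_of_le (fun n => by positivity) (fun n => ?_)
    ((summable_nat_add_iff 1).2 summable_geometric_two)
  rw [one_div, inv_pow, ← one_div]
  gcongr
  exact hd _ _

lemma rho_nonneg (u v : ℕ → X) : 0 ≤ rho u v := tsum_nonneg fun n => by positivity

lemma rho_eq_add_shiftSeq (hd : ∀ a b : X, dist a b ≤ 1) (u v : ℕ → X) :
    rho u v = dist (u 0) (v 0) / 2 + rho (shiftSeq u) (shiftSeq v) / 2 := by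
  have h := (summable_rho hd u v).tsum_eq_zero_add
  unfold rho
  rw [h, ← tsum_div_const]
  congr 1
  · simp
  · refine tsum_congr fun n => ?_
    simp only [shiftSeq]
    rw [pow_succ _ (n + 1), div_div]

lemma rho_le_one (hd : ∀ a b : X, dist a b ≤ 1) (u v : ℕ → X) : rho u v ≤ 1 := by
  rw [← tsum_geometric_two' 1]
  refine (summable_rho hd u v).tsum_le_tsum (fun n => ?_) (summable_geometric_two' 1)
  rw [pow_succ, mul_comm, div_div]
  gcongr
  exact hd _ _

lemma dist_le_two_pow_mul_rho (hd : ∀ a b : X, dist a b ≤ 1) (k : ℕ) (u v : ℕ → X) :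
    dist (u k) (v k) ≤ 2 ^ (k + 1) * rho u v := by
  induction k generalizing u v with
  | zero =>
    have h := rho_eq_add_shiftSeq hd u v
    have h' := rho_nonneg (shiftSeq u) (shiftSeq v)
    norm_num
    linarith
  | succ k ih =>
    have h := rho_eq_add_shiftSeq hd u v
    have h₁ : rho (shiftSeq u) (shiftSeq v) ≤ 2 * rho u v := by
      have := dist_nonneg (x := u 0) (y := v 0)
      linarith
    calc dist (u (k + 1)) (v (k + 1)) ≤ 2 ^ (k + 1) * rho (shiftSeq u) (shiftSeq v) :=
        ih (shiftSeq u) (shiftSeq v)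
      _ ≤ 2 ^ (k + 1) * (2 * rho u v) := by gcongr
      _ = 2 ^ (k + 1 + 1) * rho u v := by ring

lemma rho_le_add_of_forall_lt (hd : ∀ a b : X, dist a b ≤ 1) {c : ℝ} (hc : 0 ≤ c) (K : ℕ)
    (u v : ℕ → X) (h : ∀ k < K, dist (u k) (v k) ≤ c) : rho u v ≤ c + (1 / 2) ^ K := by
  induction K generalizing u v with
  | zero =>
    have := rho_le_one hd u v
    simp only [pow_zero]
    linarith
  | succ K ih =>
    have h₁ := ih (shiftSeq u) (shiftSeq v) fun k hk => h (k + 1) (by lia)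
    have h₂ := h 0 (by lia)
    rw [rho_eq_add_shiftSeq hd u v, pow_succ]
    linarith

lemma shiftSeq_iterate_apply {Y : Type*} (w : ℕ → Y) (n k : ℕ) : shiftSeq^[n] w k = w (n + k) := by
  induction n generalizing w with
  | zero => simp
  | succ n ih =>
    rw [Function.iterate_succ_apply, ih, shiftSeq]
    congr 1
    lia

end RhoEstimates

lemma dist_diagonal_le_of_rho_lt (hd : ∀ a b : X, dist a b ≤ 1) {δ : ℝ} {z : ℕ → ℕ → X}
    (hz : ∀ n, rho (shiftSeq (z n)) (z (n + 1)) < δ) (k n : ℕ) :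
    dist (z (n + k) 0) (z n k) ≤ 2 ^ (k + 1) * δ := by
  have hδ : 0 ≤ δ := (rho_nonneg _ _).trans (hz 0).le
  induction k generalizing n with
  | zero =>
    simp only [add_zero, dist_self]
    positivity
  | succ k ih =>
    have h₁ := ih (n + 1)
    have h₂ : dist (z n (k + 1)) (z (n + 1) k) ≤ 2 ^ (k + 1) * δ :=
      (dist_le_two_pow_mul_rho hd k (shiftSeq (z n)) (z (n + 1))).trans
        (by gcongr; exact (hz n).le)
    rw [show n + 1 + k = n + (k + 1) by lia] at h₁
    calc _ ≤ _ := dist_triangle_right _ _ (z (n + 1) k)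
      _ ≤ 2 ^ (k + 1) * δ + 2 ^ (k + 1) * δ := add_le_add h₁ h₂
      _ = 2 ^ (k + 1 + 1) * δ := by ring

lemma exists_half_pow_lt_half {ε : ℝ} (hε : 0 < ε) : ∃ K : ℕ, (1 / 2 : ℝ) ^ K < ε / 2 :=
  exists_pow_lt_of_lt_one (half_pos hε) (by norm_num)

lemma SVShadowing.shiftShadowingL (hd : ∀ a b : X, dist a b ≤ 1) {F : X → Set X}
    (h : SVShadowing F) : ShiftShadowingL F := by
  intro ε hε
  obtain ⟨K, hK⟩ := exists_half_pow_lt_half hε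
  obtain ⟨δ, hδ, hsh⟩ := h (ε / 4) (by positivity)
  obtain ⟨η, hη, h₁, h₂⟩ : ∃ η > 0, η ≤ δ / 2 ∧ η ≤ ε / 4 / 2 ^ K :=
    ⟨min (δ / 2) (ε / 4 / 2 ^ K), by positivity, min_le_left _ _, min_le_right _ _⟩
  refine ⟨η, hη, fun z hz hzρ => ?_⟩
  obtain ⟨y, hy, hxy⟩ := hsh (fun n => z n 0) fun n => by
    refine (infDist_le_dist_of_mem (hz n 0)).trans_lt ?_
    rw [dist_comm]
    have := dist_le_two_pow_mul_rho hd 0 (shiftSeq (z n)) (z (n + 1))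
    have h' := hzρ n
    simp only [shiftSeq, zero_add, pow_one] at this h' ⊢
    linarith
  refine ⟨y, hy, fun n => ?_⟩
  refine (rho_le_add_of_forall_lt hd (c := ε / 2) (by positivity) K _ _ fun k hk => ?_).trans_lt
    (by linarith)
  rw [shiftSeq_iterate_apply]
  have h₃ := hxy (n + k)
  have h₄ : dist (z (n + k) 0) (z n k) ≤ ε / 4 := by
    refine (dist_diagonal_le_of_rho_lt hd hzρ k n).trans ?_
    rw [le_div_iff₀ (by positivity)] at h₂
    rw [mul_comm]
    refine le_trans ?_ h₂
    gcongr
    · norm_num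
    · lia
  have h₅ := dist_triangle_left (y (n + k)) (z n k) (z (n + k) 0)
  linarith

/-- A continuous set-valued map on a compact space is uniformly continuous for the Hausdorff
distance. -/
lemma SVContinuous.exists_dist_lt_of_dist_lt [CompactSpace X] {F : X → Set X}
    (hF : SVContinuous F) (hFc : SVCompactValued F) {η : ℝ} (hη : 0 < η) :
    ∃ δ > 0, ∀ x y : X, dist x y < δ → ∀ p ∈ F x, ∃ q ∈ F y, dist p q < η := by
  have hloc : ∀ a : X, ∃ V : Set X, IsOpen V ∧ a ∈ V ∧
      ∀ x ∈ V, ∀ y ∈ V, ∀ p ∈ F x, ∃ q ∈ F y, dist p q < η := by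
    intro a
    obtain ⟨V, hV, haV, hVF⟩ := hF.1 a (thickening (η / 2) (F a)) isOpen_thickening
      (self_subset_thickening (half_pos hη) _)
    have hlow : ∀ᶠ y in nhds a, ∀ p ∈ F a, ∃ q ∈ F y, dist p q < η / 2 := by
      refine (hFc a).2.eventually_forall_of_forall_eventually fun p hp => ?_
      obtain ⟨W, hW, haW, hWF⟩ := hF.2 a (ball p (η / 4)) isOpen_ball
        ⟨p, hp, mem_ball_self (by positivity)⟩
      filter_upwards [prod_mem_nhds (hW.mem_nhds haW) (ball_mem_nhds p (ε := η / 4)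
        (by positivity))] with ⟨y, p'⟩ ⟨hy, hp'⟩
      obtain ⟨q, hq, hqp⟩ := hWF y hy
      refine ⟨q, hq, (dist_triangle_right p' q p).trans_lt ?_⟩
      rw [mem_ball] at hp' hqp
      linarith
    obtain ⟨W, hWF, hW, haW⟩ := _root_.eventually_nhds_iff.1 hlow
    refine ⟨V ∩ W, hV.inter hW, ⟨haV, haW⟩, fun x hx y hy p hp => ?_⟩
    obtain ⟨r, hr, hpr⟩ := mem_thickening_iff.1 (hVF x hx.1 hp)
    obtain ⟨q, hq, hrq⟩ := hWF y hy.2 r hr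
    exact ⟨q, hq, (dist_triangle p r q).trans_lt (by linarith)⟩
  choose V hV hmem hVF using hloc
  obtain ⟨δ, hδ, h⟩ := lebesgue_number_lemma_of_metric isCompact_univ hV
    fun a _ => mem_iUnion.2 ⟨a, hmem a⟩
  refine ⟨δ, hδ, fun x y hxy => ?_⟩
  obtain ⟨a, ha⟩ := h x (mem_univ x)
  exact hVF a x (ha (mem_ball_self hδ)) y (ha (by rwa [mem_ball, dist_comm]))

/-- An orbit obtained by always moving to a nearest point follows a pseudo-orbit for any
prescribed finite time. -/
lemma exists_forall_le_dist_lt_of_pseudoOrbit [CompactSpace X] {F : X → Set X}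
    (hF : SVContinuous F) (hFc : SVCompactValued F) (K : ℕ) {η : ℝ} (hη : 0 < η) :
    ∃ δ > 0, ∀ x z : ℕ → X, (∀ n, infDist (x (n + 1)) (F (x n)) < δ) → z 0 = x 0 →
      (∀ n, infDist (x (n + 1)) (F (z n)) = dist (x (n + 1)) (z (n + 1))) →
      ∀ k ≤ K, dist (x k) (z k) < η := by
  induction K generalizing η with
  | zero =>
    refine ⟨1, one_pos, fun x z _ h₀ _ k hk => ?_⟩
    obtain rfl : k = 0 := by lia
    simpa [h₀] using hη
  | succ K ih =>
    obtain ⟨δ₁, hδ₁, h₁⟩ := hF.exists_dist_lt_of_dist_lt hFc (half_pos hη)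
    obtain ⟨δ₂, hδ₂, h₂⟩ := ih (lt_min hδ₁ hη)
    refine ⟨min δ₂ (η / 2), by positivity, fun x z hx h₀ hz k hk => ?_⟩
    have h₃ := h₂ x z (fun n => (hx n).trans_le (min_le_left _ _)) h₀ hz
    rcases hk.lt_or_eq with hk | rfl
    · exact (h₃ k (by lia)).trans_le (min_le_right _ _)
    · obtain ⟨p, hp, hxp⟩ :=
        (infDist_lt_iff (hFc (x K)).1).1 ((hx K).trans_le (min_le_right _ _))
      obtain ⟨q, hq, hpq⟩ := h₁ _ _ ((h₃ K le_rfl).trans_le (min_le_left _ _)) p hp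
      rw [← hz K]
      refine (infDist_le_dist_of_mem hq).trans_lt ((dist_triangle _ p _).trans_lt ?_)
      linarith

lemma SVCompactValued.exists_nearest_orbit {F : X → Set X} (hFc : SVCompactValued F)
    (x : ℕ → X) : ∃ z ∈ OrbL F, z 0 = x 0 ∧
      ∀ n, infDist (x (n + 1)) (F (z n)) = dist (x (n + 1)) (z (n + 1)) := by
  choose f hf hdist using fun a b : X => (hFc a).2.exists_infDist_eq_dist (hFc a).1 b
  exact ⟨fun n => Nat.rec (x 0) (fun n a => f a (x (n + 1))) n, fun n => hf _ _, rfl,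
    fun n => hdist _ _⟩

lemma ShiftShadowingL.svShadowing [CompactSpace X] (hd : ∀ a b : X, dist a b ≤ 1)
    {F : X → Set X} (hF : SVContinuous F) (hFc : SVCompactValued F) (h : ShiftShadowingL F) :
    SVShadowing F := by
  intro ε hε
  obtain ⟨δ, hδ, hsh⟩ := h (ε / 2) (half_pos hε)
  obtain ⟨K, hK⟩ := exists_half_pow_lt_half hδ
  obtain ⟨δ', hδ', hfollow⟩ := exists_forall_le_dist_lt_of_pseudoOrbit hF hFc K
    (η := δ / 4) (by positivity)
  refine ⟨δ', hδ', fun x hx => ?_⟩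
  choose z hz hz₀ hnear using fun n => hFc.exists_nearest_orbit fun k => x (n + k)
  have hclose : ∀ n, ∀ k ≤ K, dist (x (n + k)) (z n k) < δ / 4 := fun n =>
    hfollow (fun k => x (n + k)) (z n) (fun k => hx (n + k)) (hz₀ n) (hnear n)
  obtain ⟨w, hw, hwz⟩ := hsh z hz fun n => by
    refine (rho_le_add_of_forall_lt hd (c := δ / 2) (by positivity) K _ _ fun k hk => ?_).trans_lt
      (by linarith)
    have h₁ := hclose n (k + 1) hk
    have h₂ := hclose (n + 1) k hk.le
    rw [show n + 1 + k = n + (k + 1) by lia] at h₂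
    have h₃ := dist_triangle_left (z n (k + 1)) (z (n + 1) k) (x (n + (k + 1)))
    simp only [shiftSeq]
    linarith
  refine ⟨w, hw, fun n => ?_⟩
  have h₁ := dist_le_two_pow_mul_rho hd 0 (shiftSeq^[n] w) (z n)
  have h₂ := hwz n
  rw [shiftSeq_iterate_apply, hz₀ n, dist_comm] at h₁
  simp only [add_zero, zero_add, pow_one] at h₁
  linarith

/-- For a continuous set-valued map `F` with nonempty compact values on a
compact metric space of diameter at most 1, `F` has the shadowing property (set-valued sense)
iff the shift `σ_lF` on `(Orb_l(X), ρ)` has the shadowing property (single-valued sense). -/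
theorem svShadowing_iff_shiftL_shadowing [CompactSpace X]
    (hdiam : diam (univ : Set X) ≤ 1)
    (F : X → Set X) (hF : SVContinuous F) (hFc : SVCompactValued F) :
    SVShadowing F ↔ ShiftShadowingL F := by
  have hd : ∀ a b : X, dist a b ≤ 1 := fun a b =>
    (dist_le_diam_of_mem isCompact_univ.isBounded (mem_univ a) (mem_univ b)).trans hdiam
  exact ⟨fun h => h.shiftShadowingL hd, fun h => h.svShadowing hd hF hFc⟩
end
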